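/- For all Boolean normal monotonic (BNM) schemes 𝕏, 𝕏', 𝕏'': T^d(SS(𝕏)⋆ ∪ TT(𝕏')⋆) = SS(𝕏)⋆ ∪ TT(𝕏')⋆ = ST(𝕏'')⋆. -/

import Mathlib

namespace ThreeValued

/-- Formulas of the propositional language: countably many variables,
negation, conjunction, disjunction. -/
inductive Fml : Type
  | var : ℕ → Fml
  | neg : Fml → Fml
  | conj : Fml → Fml → Fml
  | disj : Fml → Fml → Fml
deriving DecidableEq

/-- An inference Γ ⇒ φ: a finite set of premises and a conclusion. -/
structure Infer : Type where
  prem : Finset Fml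
  concl : Fml

/-- A set of inferences is closed under transitivity:
whenever there is a nonempty Δ with Δ ⇒ φ ∈ L and Γ ⇒ δ ∈ L for all δ ∈ Δ,
then Γ ⇒ φ ∈ L. -/
def TransClosed (L : Set Infer) : Prop :=
  ∀ (Γ Δ : Finset Fml) (φ : Fml), Δ.Nonempty →
    (⟨Δ, φ⟩ : Infer) ∈ L → (∀ δ ∈ Δ, (⟨Γ, δ⟩ : Infer) ∈ L) → (⟨Γ, φ⟩ : Infer) ∈ L

/-- The transitive closure of a set of inferences: the least superset closed
under transitivity. -/
def T (L : Set Infer) : Set Infer := ⋂₀ {L' : Set Infer | L ⊆ L' ∧ TransClosed L'}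

/-- A set of inferences is open under dual transitivity:
whenever there is a nonempty Δ with Δ ⇒ φ ∉ L and Γ ⇒ δ ∉ L for all δ ∈ Δ,
then Γ ⇒ φ ∉ L. -/
def DualTransClosed (L : Set Infer) : Prop :=
  ∀ (Γ Δ : Finset Fml) (φ : Fml), Δ.Nonempty →
    (⟨Δ, φ⟩ : Infer) ∉ L → (∀ δ ∈ Δ, (⟨Γ, δ⟩ : Infer) ∉ L) → (⟨Γ, φ⟩ : Infer) ∉ L

/-- The dual transitive closure: the greatest subset open under dual
transitivity. -/
def Td (L : Set Infer) : Set Infer := ⋃₀ {L' : Set Infer | L' ⊆ L ∧ DualTransClosed L'}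

/-- The three truth values 0, 1/2, 1. -/
inductive V3 : Type
  | zero | half | one
deriving DecidableEq

/-- A three-valued scheme: a triple of truth functions for ¬, ∧ and ∨. -/
structure Scheme : Type where
  fneg : V3 → V3
  fconj : V3 → V3 → V3
  fdisj : V3 → V3 → V3

/-- Boolean normality: on Boolean inputs the operations agree with the
classical ones. -/
def BooleanNormal (X : Scheme) : Prop :=
  X.fneg .zero = .one ∧ X.fneg .one = .zero ∧
  X.fconj .one .one = .one ∧ X.fconj .one .zero = .zero ∧
  X.fconj .zero .one = .zero ∧ X.fconj .zero .zero = .zero ∧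
  X.fdisj .one .one = .one ∧ X.fdisj .one .zero = .one ∧
  X.fdisj .zero .one = .one ∧ X.fdisj .zero .zero = .zero

/-- The information order: 1/2 is below 0 and below 1. -/
def infLe (a b : V3) : Prop := a = .half ∨ a = b

/-- Monotonicity of a scheme with respect to the information order. -/
def Monotonic (X : Scheme) : Prop :=
  (∀ a b, infLe a b → infLe (X.fneg a) (X.fneg b)) ∧
  (∀ a₁ a₂ b₁ b₂, infLe a₁ b₁ → infLe a₂ b₂ → infLe (X.fconj a₁ a₂) (X.fconj b₁ b₂)) ∧
  (∀ a₁ a₂ b₁ b₂, infLe a₁ b₁ → infLe a₂ b₂ → infLe (X.fdisj a₁ a₂) (X.fdisj b₁ b₂))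

/-- Boolean normal monotonic schemes. -/
def BNM (X : Scheme) : Prop := BooleanNormal X ∧ Monotonic X

/-- Valuations respecting a scheme. -/
def Respects (X : Scheme) (v : Fml → V3) : Prop :=
  (∀ φ, v (.neg φ) = X.fneg (v φ)) ∧
  (∀ φ ψ, v (.conj φ ψ) = X.fconj (v φ) (v ψ)) ∧
  (∀ φ ψ, v (.disj φ ψ) = X.fdisj (v φ) (v ψ))

/-- The strict formula-standard s = {1}. -/
def sStd : Set V3 := {.one}

/-- The tolerant formula-standard t = {1, 1/2}. -/
def tStd : Set V3 := {.one, .half}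

/-- An inference is xy-valid over a scheme X if every valuation respecting X
whose value on each premise is in x gives the conclusion a value in y. -/
def Valid (X : Scheme) (x y : Set V3) (I : Infer) : Prop :=
  ∀ v : Fml → V3, Respects X v → (∀ γ ∈ I.prem, v γ ∈ x) → v I.concl ∈ y

/-- The ss-valid inferences over X. -/
def SS (X : Scheme) : Set Infer := {I | Valid X sStd sStd I}

/-- The tt-valid inferences over X. -/
def TT (X : Scheme) : Set Infer := {I | Valid X tStd tStd I}

/-- The st-valid inferences over X. -/
def ST (X : Scheme) : Set Infer := {I | Valid X sStd tStd I}

/-- The ts-valid inferences over X. -/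
def TS (X : Scheme) : Set Infer := {I | Valid X tStd sStd I}

/-- Classical two-valued valuations. -/
def RespectsCL (v : Fml → Bool) : Prop :=
  (∀ φ, v (.neg φ) = ! v φ) ∧
  (∀ φ ψ, v (.conj φ ψ) = (v φ && v ψ)) ∧
  (∀ φ ψ, v (.disj φ ψ) = (v φ || v ψ))

/-- The classically valid inferences. -/
def CL : Set Infer :=
  {I | ∀ v : Fml → Bool, RespectsCL v → (∀ γ ∈ I.prem, v γ = true) → v I.concl = true}

/-- Substitution: the homomorphic extension of a map from variables to
formulas. -/
def subst (σ : ℕ → Fml) : Fml → Fml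
  | .var n => σ n
  | .neg φ => .neg (subst σ φ)
  | .conj φ ψ => .conj (subst σ φ) (subst σ ψ)
  | .disj φ ψ => .disj (subst σ φ) (subst σ ψ)

/-- Reflexivity. -/
def PropR (L : Set Infer) : Prop := ∀ φ : Fml, (⟨{φ}, φ⟩ : Infer) ∈ L

/-- Monotonicity (weakening). -/
def PropM (L : Set Infer) : Prop :=
  ∀ (Γ Sg : Finset Fml) (φ : Fml), (⟨Γ, φ⟩ : Infer) ∈ L → Γ ⊆ Sg → (⟨Sg, φ⟩ : Infer) ∈ L

/-- Structurality (closure under substitutions). -/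
def PropS (L : Set Infer) : Prop :=
  ∀ (Γ : Finset Fml) (φ : Fml), (⟨Γ, φ⟩ : Infer) ∈ L →
    ∀ σ : ℕ → Fml, (⟨Γ.image (subst σ), subst σ φ⟩ : Infer) ∈ L

/-- The Tarskian closure: the least superset satisfying (R), (M), (T), (S). -/
def Tar (L : Set Infer) : Set Infer :=
  ⋂₀ {L' : Set Infer | L ⊆ L' ∧ PropR L' ∧ PropM L' ∧ TransClosed L' ∧ PropS L'}

/-- L⋆: the inferences whose premise set is an antitheorem of L or whose
conclusion is a theorem of L. -/
def starL (L : Set Infer) : Set Infer :=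
  {I | (∀ ψ : Fml, (⟨I.prem, ψ⟩ : Infer) ∈ L) ∨ (∀ Δ : Finset Fml, (⟨Δ, I.concl⟩ : Infer) ∈ L)}

/-- The propositional variables occurring in a formula. -/
def fvars : Fml → Finset ℕ
  | .var n => {n}
  | .neg φ => fvars φ
  | .conj φ ψ => fvars φ ∪ fvars ψ
  | .disj φ ψ => fvars φ ∪ fvars ψ

/-- A set of premises with no classical model. -/
def Unsat (Γ : Finset Fml) : Prop :=
  ∀ v : Fml → Bool, RespectsCL v → ¬ ∀ γ ∈ Γ, v γ = true

/-- A classical tautology. -/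
def Taut (φ : Fml) : Prop := ∀ v : Fml → Bool, RespectsCL v → v φ = true

/-- The embedding of the Boolean values into the three values. -/
def ofBool (b : Bool) : V3 := if b then .one else .zero

/-- The classical evaluation of formulas under a Boolean assignment. -/
def evalCL (e : ℕ → Bool) : Fml → Bool
  | .var n => e n
  | .neg φ => ! evalCL e φ
  | .conj φ ψ => evalCL e φ && evalCL e ψ
  | .disj φ ψ => evalCL e φ || evalCL e ψ

lemma respectsCL_evalCL (e : ℕ → Bool) : RespectsCL (evalCL e) :=
  ⟨fun _ => rfl, fun _ _ => rfl, fun _ _ => rfl⟩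

lemma BooleanNormal.fneg_ofBool {X : Scheme} (hX : BooleanNormal X) (a : Bool) :
    X.fneg (ofBool a) = ofBool (!a) := by
  obtain ⟨h0, h1, -⟩ := hX
  cases a <;> simpa [ofBool]

lemma BooleanNormal.fconj_ofBool {X : Scheme} (hX : BooleanNormal X) (a b : Bool) :
    X.fconj (ofBool a) (ofBool b) = ofBool (a && b) := by
  obtain ⟨-, -, h11, h10, h01, h00, -⟩ := hX
  cases a <;> cases b <;> simpa [ofBool]

lemma BooleanNormal.fdisj_ofBool {X : Scheme} (hX : BooleanNormal X) (a b : Bool) :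
    X.fdisj (ofBool a) (ofBool b) = ofBool (a || b) := by
  obtain ⟨-, -, -, -, -, -, h11, h10, h01, h00⟩ := hX
  cases a <;> cases b <;> simpa [ofBool]

/-- Classical valuations are valuations of every Boolean normal scheme. -/
lemma BooleanNormal.respects_ofBool {X : Scheme} (hX : BooleanNormal X) {v : Fml → Bool}
    (hv : RespectsCL v) : Respects X (fun φ => ofBool (v φ)) := by
  obtain ⟨hn, hc, hd⟩ := hv
  refine ⟨fun φ => ?_, fun φ ψ => ?_, fun φ ψ => ?_⟩
  · simp only [hX.fneg_ofBool, hn]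
  · simp only [hX.fconj_ofBool, hc]
  · simp only [hX.fdisj_ofBool, hd]

/-- Every valuation of a BNM scheme is refined by a classical valuation. -/
lemma BNM.exists_refinement {X : Scheme} (hX : BNM X) {v : Fml → V3} (hv : Respects X v) :
    ∃ w : Fml → Bool, RespectsCL w ∧ ∀ φ, infLe (v φ) (ofBool (w φ)) := by
  obtain ⟨hB, mn, mc, md⟩ := hX
  obtain ⟨hn, hc, hd⟩ := hv
  refine ⟨evalCL fun n => v (.var n) == .one, respectsCL_evalCL _, fun φ => ?_⟩
  induction φ with
  | var n => cases h : v (.var n) <;> simp [evalCL, infLe, ofBool, h]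
  | neg φ ih =>
    rw [hn, evalCL, ← hB.fneg_ofBool]
    exact mn _ _ ih
  | conj φ ψ ih₁ ih₂ =>
    rw [hc, evalCL, ← hB.fconj_ofBool]
    exact mc _ _ _ _ ih₁ ih₂
  | disj φ ψ ih₁ ih₂ =>
    rw [hd, evalCL, ← hB.fdisj_ofBool]
    exact md _ _ _ _ ih₁ ih₂

lemma Valid.mem_CL {X : Scheme} (hX : BooleanNormal X) {x y : Set V3} (hx : .one ∈ x)
    (hy : .zero ∉ y) {I : Infer} (h : Valid X x y I) : I ∈ CL := by
  intro v hv hΓ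
  have hI := h _ (hX.respects_ofBool hv) fun γ hγ => by simpa [ofBool, hΓ γ hγ] using hx
  by_contra hc
  exact hy (by simpa [ofBool, hc] using hI)

lemma Unsat.valid {X : Scheme} (hX : BNM X) {Γ : Finset Fml} (h : Unsat Γ) (y : Set V3)
    (ψ : Fml) : Valid X sStd y ⟨Γ, ψ⟩ := by
  intro v hv hΓ
  obtain ⟨w, hw, hle⟩ := hX.exists_refinement hv
  refine absurd (fun γ hγ => ?_) (h w hw)
  have h1 : v γ = .one := hΓ γ hγ
  have h2 := hle γ
  cases hb : w γ <;> simp_all [infLe, ofBool]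

lemma Taut.valid {X : Scheme} (hX : BNM X) {φ : Fml} (h : Taut φ) (x : Set V3)
    (Δ : Finset Fml) : Valid X x tStd ⟨Δ, φ⟩ := by
  intro v hv _
  obtain ⟨w, hw, hle⟩ := hX.exists_refinement hv
  have h2 := hle φ
  rw [h w hw] at h2
  exact h2.symm

lemma unsat_or_taut_of_mem_starL {L : Set Infer} (hL : L ⊆ CL) {I : Infer}
    (hI : I ∈ starL L) : Unsat I.prem ∨ Taut I.concl := by
  refine hI.imp (fun h v hv hΓ => ?_) (fun h v hv => ?_)
  · have := hL (h (.conj (.var 0) (.neg (.var 0)))) v hv hΓ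
    simp [hv.1, hv.2.1] at this
  · exact hL (h ∅) v hv (by simp)

lemma starL_SS_union_starL_TT {X X' : Scheme} (hX : BNM X) (hX' : BNM X') :
    starL (SS X) ∪ starL (TT X') = {I | Unsat I.prem ∨ Taut I.concl} := by
  ext I
  constructor
  · rintro (h | h)
    · exact unsat_or_taut_of_mem_starL
        (fun J hJ => Valid.mem_CL hX.1 (by simp [sStd]) (by simp [sStd]) hJ) h
    · exact unsat_or_taut_of_mem_starL
        (fun J hJ => Valid.mem_CL hX'.1 (by simp [tStd]) (by simp [tStd]) hJ) h
  · rintro (h | h)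
    · exact .inl (.inl fun ψ => h.valid hX _ ψ)
    · exact .inr (.inr fun Δ => h.valid hX' _ Δ)

lemma starL_ST {X : Scheme} (hX : BNM X) :
    starL (ST X) = {I | Unsat I.prem ∨ Taut I.concl} := by
  ext I
  constructor
  · exact unsat_or_taut_of_mem_starL
      (fun J hJ => Valid.mem_CL hX.1 (by simp [sStd]) (by simp [tStd]) hJ)
  · rintro (h | h)
    · exact .inl fun ψ => h.valid hX _ ψ
    · exact .inr fun Δ => h.valid hX _ Δ

lemma Td_eq_self {L : Set Infer} (hL : DualTransClosed L) : Td L = L :=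
  Set.Subset.antisymm (Set.sUnion_subset fun _ h => h.1)
    (Set.subset_sUnion_of_mem ⟨Set.Subset.rfl, hL⟩)

lemma dualTransClosed_unsat_or_taut :
    DualTransClosed {I | Unsat I.prem ∨ Taut I.concl} := by
  rintro Γ Δ φ ⟨δ, hδ⟩ h₁ h₂ (h | h)
  · exact h₂ δ hδ (.inl h)
  · exact h₁ (.inr h)

/-- Td(SS⋆ ∪ TT⋆) = SS⋆ ∪ TT⋆ = ST⋆ over (possibly different) BNM schemes. -/
theorem stmt17 : ∀ X X' X'' : Scheme, BNM X → BNM X' → BNM X'' →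
    Td (starL (SS X) ∪ starL (TT X')) = starL (SS X) ∪ starL (TT X') ∧
    starL (SS X) ∪ starL (TT X') = starL (ST X'') := by
  intro X X' X'' hX hX' hX''
  rw [starL_SS_union_starL_TT hX hX', starL_ST hX'']
  exact ⟨Td_eq_self dualTransClosed_unsat_or_taut, rfl⟩

end ThreeValued
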